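/- arXiv:1408.4192 — 2 statements merged into one kernel-verified Lean document; each statement's English description precedes it below -/
import Mathlib

section
/- Let λ1, λ2, μ1, μ2, μ3 > 0 with ρ1 = λ1/μ1 < 1 and ρ1 + ρ2 < 1 where ρ2 = λ2/μ2, let N ≥ 1 be an integer, and let P be a real number. Suppose Q2, Q3 : (0,1) → ℝ have limits Q2(1) := lim_{y→1⁻} Q2(y) and Q3(1) := lim_{y→1⁻} Q3(y), and satisfy, for every y ∈ (0,1): (A(y) − λ1·α(y)·y)·Q2(y) + (λ1(1−α(y)) + λ2(1−y))·Q3(y) = μ3·{ (ρ1+ρ2)·L3(y) − (1−ρ1−ρ2)·[ y·L2(y) + Λ(y) ] }·P, where Λ(y) = α(y)·(y·L2(y)+L3(y))/(x2(y)−x1(y)). Then (1/(1−ρ1))·[ (1−ρ1−ρ2)·Q2(1) − ρ2·Q3(1) ] = { −(μ3/μ1)·[ ρ1ρ2/(1−ρ1) + ρ1ρ2(1−ρ1−ρ2)/(1−ρ1)² ] − (μ3/μ2)·ρ2 }·P. -/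
open Real Filter Topology Set

noncomputable section

/-- The kernel discriminant Δ(y) = (λ+μ1−λ2·y)² − 4λ1μ1 with λ = λ1+λ2. -/
def Delta (l1 l2 m1 y : ℝ) : ℝ := (l1 + l2 + m1 - l2 * y) ^ 2 - 4 * l1 * m1

/-- The small kernel root α(y) = x1(y). -/
def alphaf (l1 l2 m1 y : ℝ) : ℝ :=
  (l1 + l2 + m1 - l2 * y - Real.sqrt (Delta l1 l2 m1 y)) / (2 * l1)

/-- The large kernel root x2(y). -/
def x2f (l1 l2 m1 y : ℝ) : ℝ :=
  (l1 + l2 + m1 - l2 * y + Real.sqrt (Delta l1 l2 m1 y)) / (2 * l1)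

/-- The kernel K(x,y) = λ1(1−x) + λ2(1−y) + μ1(1−1/x). -/
def Kker (l1 l2 m1 x y : ℝ) : ℝ :=
  l1 * (1 - x) + l2 * (1 - y) + m1 * (1 - 1 / x)

/-- A(y) = y·a(y) = λ1·y + λ2·y(1−y) + μ2·(y−1). -/
def Afun (l1 l2 m2 y : ℝ) : ℝ := l1 * y + l2 * y * (1 - y) + m2 * (y - 1)

/-- β(y) = H(y)/H(1) where H(y) = Σ_{k<N} (r2·y)^k and r2 = λ2/(λ1+λ2). -/
def betaf (l1 l2 : ℝ) (N : ℕ) (y : ℝ) : ℝ :=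
  (∑ k ∈ Finset.range N, (l2 / (l1 + l2) * y) ^ k) /
    (∑ k ∈ Finset.range N, (l2 / (l1 + l2) * 1) ^ k)

/-- L3(y) = β(y)(1−ρ1−ρ2). -/
def L3f (l1 l2 m1 m2 : ℝ) (N : ℕ) (y : ℝ) : ℝ :=
  betaf l1 l2 N y * (1 - l1 / m1 - l2 / m2)

/-- L2(y) = [λ1(α(y)−1)+λ2(y−1)]·L3(y)/(A(y)−λ1·y·α(y)). -/
def L2f (l1 l2 m1 m2 : ℝ) (N : ℕ) (y : ℝ) : ℝ :=
  (l1 * (alphaf l1 l2 m1 y - 1) + l2 * (y - 1)) * L3f l1 l2 m1 m2 N y /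
    (Afun l1 l2 m2 y - l1 * y * alphaf l1 l2 m1 y)

/-- L1(x,y) = λ1μ2(x−α(y))(y−1)·L3(y)/(x·K(x,y)·(A(y)−λ1·y·α(y))). -/
def L1f (l1 l2 m1 m2 : ℝ) (N : ℕ) (x y : ℝ) : ℝ :=
  l1 * m2 * (x - alphaf l1 l2 m1 y) * (y - 1) * L3f l1 l2 m1 m2 N y /
    (x * Kker l1 l2 m1 x y * (Afun l1 l2 m2 y - l1 * y * alphaf l1 l2 m1 y))

/-- Λ(y) = α(y)·(y·L2(y)+L3(y))/(x2(y)−x1(y)). -/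
def Lamf (l1 l2 m1 m2 : ℝ) (N : ℕ) (y : ℝ) : ℝ :=
  alphaf l1 l2 m1 y * (y * L2f l1 l2 m1 m2 N y + L3f l1 l2 m1 m2 N y) /
    (x2f l1 l2 m1 y - alphaf l1 l2 m1 y)

/-- b1 = λ2/(λ2+(√μ1−√λ1)²). -/
def b1v (l1 l2 m1 : ℝ) : ℝ := l2 / (l2 + (Real.sqrt m1 - Real.sqrt l1) ^ 2)

/-- b2 = λ2/(λ2+(√μ1+√λ1)²). -/
def b2v (l1 l2 m1 : ℝ) : ℝ := l2 / (l2 + (Real.sqrt m1 + Real.sqrt l1) ^ 2)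

/-- F(y) = λ2·y² − (1−2μ1+μ2)·y + 2μ2. -/
def Ff (l2 m1 m2 y : ℝ) : ℝ := l2 * y ^ 2 - (1 - 2 * m1 + m2) * y + 2 * m2

/-- T*(y) = F(y) + y·√Δ(y). -/
def Tstar (l1 l2 m1 m2 y : ℝ) : ℝ :=
  Ff l2 m1 m2 y + y * Real.sqrt (Delta l1 l2 m1 y)

/-- T(y) = F(y) − y·√Δ(y). -/
def Tm (l1 l2 m1 m2 y : ℝ) : ℝ :=
  Ff l2 m1 m2 y - y * Real.sqrt (Delta l1 l2 m1 y)

/-- η1 = ((1−2μ1) + √((1−2μ1)²+4(μ1−μ2)λ2))/(2μ2). -/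
def eta1 (l2 m1 m2 : ℝ) : ℝ :=
  (1 - 2 * m1 + Real.sqrt ((1 - 2 * m1) ^ 2 + 4 * (m1 - m2) * l2)) / (2 * m2)

/-- η2 = ((1−2μ1) − √((1−2μ1)²+4(μ1−μ2)λ2))/(2μ2). -/
def eta2 (l2 m1 m2 : ℝ) : ℝ :=
  (1 - 2 * m1 - Real.sqrt ((1 - 2 * m1) ^ 2 + 4 * (m1 - m2) * l2)) / (2 * m2)

/-- a = ((1−ρ1−ρ2)/(2μ2))·η1/(η1−η2). -/
def av (l1 l2 m1 m2 : ℝ) : ℝ :=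
  (1 - l1 / m1 - l2 / m2) / (2 * m2) * (eta1 l2 m1 m2 / (eta1 l2 m1 m2 - eta2 l2 m1 m2))

/-- b = ((1−ρ1−ρ2)/(2μ2))·η2/(η2−η1). -/
def bv (l1 l2 m1 m2 : ℝ) : ℝ :=
  (1 - l1 / m1 - l2 / m2) / (2 * m2) * (eta2 l2 m1 m2 / (eta2 l2 m1 m2 - eta1 l2 m1 m2))

/-- ι(y) = (μ1−λ+λ2y−√Δ(y))/(2μ2(y−1)). -/
def iotaf (l1 l2 m1 m2 y : ℝ) : ℝ :=
  (m1 - (l1 + l2) + l2 * y - Real.sqrt (Delta l1 l2 m1 y)) / (2 * m2 * (y - 1))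

/-- κ(y) = (2μ2(1−y) − (1−μ1y)·T(y))/(2μ1μ2·y(1−y)(1−ρ̄1·y)). -/
def kappaf (l1 l2 m1 m2 y : ℝ) : ℝ :=
  (2 * m2 * (1 - y) - (1 - m1 * y) * Tm l1 l2 m1 m2 y) /
    (2 * m1 * m2 * y * (1 - y) * (1 - (l1 + l2) / m1 * y))

/-- c0 = ((λ+μ1) − √((λ+μ1)² − 4λ1μ1))/(2μ1). -/
def c0v (l1 l2 m1 : ℝ) : ℝ :=
  (l1 + l2 + m1 - Real.sqrt ((l1 + l2 + m1) ^ 2 - 4 * l1 * m1)) / (2 * m1)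

/-- c1 = λ2·c0/√((λ+μ1)² − 4λ1μ1). -/
def c1v (l1 l2 m1 : ℝ) : ℝ :=
  l2 * c0v l1 l2 m1 / Real.sqrt ((l1 + l2 + m1) ^ 2 - 4 * l1 * m1)

/-- D = (λ+μ1−2√(λ1μ1))(μ1−μ2−√(λ1μ1)) + λ2μ2. -/
def Dv (l1 l2 m1 m2 : ℝ) : ℝ :=
  (l1 + l2 + m1 - 2 * Real.sqrt (l1 * m1)) * (m1 - m2 - Real.sqrt (l1 * m1)) + l2 * m2

/-- K(η) = λ2·b1·√(1 − b2/b1)/(2·√(b1·b2)·(η − b1)). -/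
def Kcv (l1 l2 m1 η : ℝ) : ℝ :=
  l2 * b1v l1 l2 m1 * Real.sqrt (1 - b2v l1 l2 m1 / b1v l1 l2 m1) /
    (2 * Real.sqrt (b1v l1 l2 m1 * b2v l1 l2 m1) * (η - b1v l1 l2 m1))

/-- σ(η) = K(η)/(b1·√π). -/
def sigmav (l1 l2 m1 η : ℝ) : ℝ :=
  Kcv l1 l2 m1 η / (b1v l1 l2 m1 * Real.sqrt Real.pi)

/-- K1(η). -/
def K1v (l1 l2 m1 m2 η : ℝ) : ℝ :=
  l2 * b1v l1 l2 m1 * Real.sqrt (1 - b2v l1 l2 m1 / b1v l1 l2 m1) *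
      ((1 - m1 / b1v l1 l2 m1) * (Ff l2 m1 m2 (1 / b1v l1 l2 m1) + 1)
        - 2 * m2 * (1 - 1 / b1v l1 l2 m1)) /
    (4 * m1 * m2 * Real.sqrt (b1v l1 l2 m1 * b2v l1 l2 m1) * (1 - η / b1v l1 l2 m1) *
      (1 - 1 / b1v l1 l2 m1) * (1 - (l1 + l2) / m1 / b1v l1 l2 m1))

/-- σ1(η) = K1(η)/(b1·√π). -/
def sigma1v (l1 l2 m1 m2 η : ℝ) : ℝ :=
  K1v l1 l2 m1 m2 η / (b1v l1 l2 m1 * Real.sqrt Real.pi)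

theorem Delta_one (l1 l2 m1 : ℝ) : Delta l1 l2 m1 1 = (m1 - l1) ^ 2 := by
  unfold Delta; ring

theorem sqrt_Delta_one {l1 l2 m1 : ℝ} (h : l1 < m1) : √(Delta l1 l2 m1 1) = m1 - l1 := by
  rw [Delta_one, Real.sqrt_sq (by linarith)]

theorem alphaf_one {l1 l2 m1 : ℝ} (hl1 : 0 < l1) (h : l1 < m1) : alphaf l1 l2 m1 1 = 1 := by
  rw [alphaf, sqrt_Delta_one h]
  field_simp
  ring

theorem hasDerivAt_sqrt_Delta_one {l1 l2 m1 : ℝ} (h : l1 < m1) :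
    HasDerivAt (fun y => √(Delta l1 l2 m1 y)) (-(l2 * (l1 + m1) / (m1 - l1))) 1 := by
  have hd : m1 - l1 ≠ 0 := by linarith
  have hD : HasDerivAt (fun y => Delta l1 l2 m1 y) (-(2 * l2 * (l1 + m1))) 1 := by
    unfold Delta
    refine HasDerivAt.congr_deriv (((((hasDerivAt_id (1 : ℝ)).const_mul l2).const_sub
      (l1 + l2 + m1)).pow 2).sub_const (4 * l1 * m1)) ?_
    simp only [id]
    ring
  convert hD.sqrt (by rw [Delta_one]; positivity) using 1
  rw [sqrt_Delta_one h]
  field_simp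

theorem hasDerivAt_alphaf_one {l1 l2 m1 : ℝ} (hl1 : 0 < l1) (h : l1 < m1) :
    HasDerivAt (alphaf l1 l2 m1) (l2 / (m1 - l1)) 1 := by
  have hd : m1 - l1 ≠ 0 := by linarith
  unfold alphaf
  refine HasDerivAt.congr_deriv (((((hasDerivAt_id (1 : ℝ)).const_mul l2).const_sub
    (l1 + l2 + m1)).sub (hasDerivAt_sqrt_Delta_one (l2 := l2) h)).div_const (2 * l1)) ?_
  field_simp
  ring

/-- The small root annihilates the kernel quadratic. -/
theorem alphaf_quadratic {l1 l2 m1 y : ℝ} (hl1 : 0 < l1) (h : 0 ≤ Delta l1 l2 m1 y) :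
    l1 * alphaf l1 l2 m1 y ^ 2 - (l1 + l2 + m1 - l2 * y) * alphaf l1 l2 m1 y + m1 = 0 := by
  have hs := Real.sq_sqrt h
  rw [alphaf]
  generalize √(Delta l1 l2 m1 y) = s at hs ⊢
  rw [Delta] at hs
  field_simp
  linear_combination hs

/-- Rationalised form of the ratio `L2 / L3`, without the removable singularity at `y = 1`. -/
theorem L2f_eq {l1 l2 m1 m2 y : ℝ} (N : ℕ) (hl1 : 0 < l1) (hl2 : 0 < l2) (hm1 : 0 < m1)
    (hy : y ≠ 1) (hD : 0 ≤ Delta l1 l2 m1 y)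
    (hE : m2 * (m1 - l1 * alphaf l1 l2 m1 y) - m1 * l2 * y ≠ 0) :
    L2f l1 l2 m1 m2 N y =
      m1 * l2 / (m2 * (m1 - l1 * alphaf l1 l2 m1 y) - m1 * l2 * y) * L3f l1 l2 m1 m2 N y := by
  have hq := alphaf_quadratic hl1 hD
  rw [L2f, Afun]
  generalize alphaf l1 l2 m1 y = a at hE hq ⊢
  generalize L3f l1 l2 m1 m2 N y = L
  have ha : a ≠ 0 := by
    rintro rfl
    simp at hq
    exact hm1.ne' hq
  have ha1 : a - 1 ≠ 0 := by
    intro h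
    obtain rfl : a = 1 := by linarith
    have : l2 * (y - 1) = 0 := by linear_combination hq
    exact (mul_ne_zero hl2.ne' (sub_ne_zero.2 hy)) this
  have key : (l1 * y + l2 * y * (1 - y) + m2 * (y - 1) - l1 * y * a) * (l2 * a)
      = (a - 1) * (m2 * (m1 - l1 * a) - m1 * l2 * y) := by
    linear_combination (-(l2 * y) + m2) * hq
  have hden : l1 * y + l2 * y * (1 - y) + m2 * (y - 1) - l1 * y * a ≠ 0 := by
    intro h0
    rw [h0, zero_mul] at key
    exact mul_ne_zero ha1 hE key.symm
  have hn : (l1 * (a - 1) + l2 * (y - 1)) * a = m1 * (a - 1) := by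
    linear_combination hq
  rw [div_mul_eq_mul_div, div_eq_div_iff hden hE]
  apply mul_right_cancel₀ ha
  linear_combination L * (m2 * (m1 - l1 * a) - m1 * l2 * y) * hn - L * m1 * key

theorem tendsto_betaf_one {l1 l2 : ℝ} (hl1 : 0 < l1) (hl2 : 0 < l2) {N : ℕ} (hN : 1 ≤ N) :
    Tendsto (betaf l1 l2 N) (𝓝 1) (𝓝 1) := by
  have hpos : 0 < ∑ k ∈ Finset.range N, (l2 / (l1 + l2) * 1) ^ k :=
    Finset.sum_pos (fun k _ => by positivity) ⟨0, Finset.mem_range.2 hN⟩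
  have hc : Continuous (betaf l1 l2 N) := by
    unfold betaf
    fun_prop
  have h1 : betaf l1 l2 N 1 = 1 := div_self hpos.ne'
  simpa only [h1] using hc.tendsto 1

/-- The right-hand side of the kernel-reduced equation, divided by `m3 * L3 * P`. -/
def reducedRhs (l1 l2 m1 m2 y : ℝ) : ℝ :=
  l1 / m1 + l2 / m2 - (1 - l1 / m1 - l2 / m2) *
    (y * (m1 * l2 / (m2 * (m1 - l1 * alphaf l1 l2 m1 y) - m1 * l2 * y)) +
      alphaf l1 l2 m1 y *
        (y * (m1 * l2 / (m2 * (m1 - l1 * alphaf l1 l2 m1 y) - m1 * l2 * y)) + 1) * l1 /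
        √(Delta l1 l2 m1 y))

theorem reducedRhs_one {l1 l2 m1 m2 : ℝ} (hl1 : 0 < l1) (hm1 : 0 < m1) (hm2 : 0 < m2)
    (h : l1 < m1) (hE : m2 * (m1 - l1) - m1 * l2 ≠ 0) : reducedRhs l1 l2 m1 m2 1 = 0 := by
  have hd : m1 - l1 ≠ 0 := by linarith
  simp only [reducedRhs, alphaf_one hl1 h, sqrt_Delta_one h, mul_one, one_mul]
  field_simp
  ring

theorem hasDerivAt_reducedRhs_one {l1 l2 m1 m2 : ℝ} (hl1 : 0 < l1) (hm1 : 0 < m1)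
    (hm2 : 0 < m2) (h : l1 < m1) (hE : m2 * (m1 - l1) - m1 * l2 ≠ 0) :
    HasDerivAt (reducedRhs l1 l2 m1 m2)
      (-(m2 * ((1 / m1) * ((l1 / m1) * (l2 / m2) / (1 - l1 / m1)
            + (l1 / m1) * (l2 / m2) * (1 - l1 / m1 - l2 / m2) / (1 - l1 / m1) ^ 2)
          + (1 / m2) * (l2 / m2))) / (1 - l1 / m1 - l2 / m2)) 1 := by
  have hd : m1 - l1 ≠ 0 := by linarith
  have hσ : 1 - l1 / m1 - l2 / m2 = (m2 * (m1 - l1) - m1 * l2) / (m1 * m2) := by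
    field_simp
  have hρ : 1 - l1 / m1 = (m1 - l1) / m1 := by field_simp
  have ha := hasDerivAt_alphaf_one (l2 := l2) hl1 h
  have hs := hasDerivAt_sqrt_Delta_one (l2 := l2) h
  have hid := hasDerivAt_id (1 : ℝ)
  have hg := (hasDerivAt_const (1 : ℝ) (m1 * l2)).div
    ((((ha.const_mul l1).const_sub m1).const_mul m2).sub (hid.const_mul (m1 * l2)))
    (by simpa [alphaf_one hl1 h] using hE)
  have hyg := hid.mul hg
  have hL := ((ha.mul (hyg.add_const 1)).mul_const l1).div hs
    (by rw [sqrt_Delta_one h]; exact hd)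
  have hW := ((hyg.add hL).const_mul (1 - l1 / m1 - l2 / m2)).const_sub (l1 / m1 + l2 / m2)
  refine HasDerivAt.congr_deriv (f := reducedRhs l1 l2 m1 m2) hW ?_
  simp only [Pi.mul_apply, Pi.div_apply, Pi.sub_apply, id, alphaf_one hl1 h,
    sqrt_Delta_one h, mul_one, one_mul]
  rw [hσ, hρ]
  clear hσ hW hL hyg hg hs ha
  generalize hEE : m2 * (m1 - l1) - m1 * l2 = E at hE ⊢
  obtain rfl : l2 = (m2 * (m1 - l1) - E) / m1 := by field_simp; linarith
  field_simp
  ring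

/-- L'Hôpital limit of the kernel-reduced first-order equation (3f11). -/
theorem stmt5 (l1 l2 m1 m2 m3 : ℝ) (hl1 : 0 < l1) (hl2 : 0 < l2) (hm1 : 0 < m1)
    (hm2 : 0 < m2) (hm3 : 0 < m3)
    (hr1 : l1 / m1 < 1) (hr : l1 / m1 + l2 / m2 < 1)
    (N : ℕ) (hN : 1 ≤ N) (P : ℝ)
    (Q2 Q3 : ℝ → ℝ) (q2 q3 : ℝ)
    (hQ2 : Tendsto Q2 (𝓝[<] (1:ℝ)) (𝓝 q2))
    (hQ3 : Tendsto Q3 (𝓝[<] (1:ℝ)) (𝓝 q3))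
    (heq : ∀ y ∈ Ioo (0:ℝ) 1,
      (Afun l1 l2 m2 y - l1 * alphaf l1 l2 m1 y * y) * Q2 y
          + (l1 * (1 - alphaf l1 l2 m1 y) + l2 * (1 - y)) * Q3 y
        = m3 * ((l1 / m1 + l2 / m2) * L3f l1 l2 m1 m2 N y
            - (1 - l1 / m1 - l2 / m2)
              * (y * L2f l1 l2 m1 m2 N y + Lamf l1 l2 m1 m2 N y)) * P) :
    (1 / (1 - l1 / m1)) * ((1 - l1 / m1 - l2 / m2) * q2 - (l2 / m2) * q3)
      = (-(m3 / m1) * ((l1 / m1) * (l2 / m2) / (1 - l1 / m1)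
            + (l1 / m1) * (l2 / m2) * (1 - l1 / m1 - l2 / m2) / (1 - l1 / m1) ^ 2)
          - (m3 / m2) * (l2 / m2)) * P := by
  have hlt : l1 < m1 := by rwa [div_lt_one hm1] at hr1
  have hd : m1 - l1 ≠ 0 := by linarith
  have hE : 0 < m2 * (m1 - l1) - m1 * l2 := by
    rw [div_add_div _ _ hm1.ne' hm2.ne', div_lt_one (by positivity)] at hr
    linarith
  have ha := hasDerivAt_alphaf_one (l2 := l2) hl1 hlt
  have ha1 := alphaf_one (l2 := l2) hl1 hlt
  have hid := hasDerivAt_id (1 : ℝ)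
  -- the two coefficient functions on the left, both vanishing at `1`
  have hA : HasDerivAt (fun y => Afun l1 l2 m2 y - l1 * alphaf l1 l2 m1 y * y)
      (m2 - l2 * m1 / (m1 - l1)) 1 := by
    unfold Afun
    refine HasDerivAt.congr_deriv ((((hid.const_mul l1).add ((hid.const_mul l2).mul
      (hid.const_sub 1))).add ((hid.sub_const 1).const_mul m2)).sub
      ((ha.const_mul l1).mul hid)) ?_
    simp only [id, ha1]
    field_simp
    ring
  have hn : HasDerivAt (fun y => l1 * (1 - alphaf l1 l2 m1 y) + l2 * (1 - y))
      (-(l2 * m1 / (m1 - l1))) 1 := by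
    refine HasDerivAt.congr_deriv (((ha.const_sub 1).const_mul l1).add
      ((hid.const_sub 1).const_mul l2)) ?_
    field_simp
    ring
  have hW := hasDerivAt_reducedRhs_one hl1 hm1 hm2 hlt hE.ne'
  have hmono : 𝓝[<] (1 : ℝ) ≤ 𝓝[≠] 1 := nhdsWithin_mono _ fun y hy => ne_of_lt hy
  have hlim := (((hasDerivAt_iff_tendsto_slope.1 hA).mono_left hmono).mul hQ2).add
    (((hasDerivAt_iff_tendsto_slope.1 hn).mono_left hmono).mul hQ3)
  have hβ : Tendsto (L3f l1 l2 m1 m2 N) (𝓝[<] 1) (𝓝 (1 * (1 - l1 / m1 - l2 / m2))) :=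
    ((tendsto_betaf_one hl1 hl2 hN).mono_left nhdsWithin_le_nhds).mul_const _
  have hlim' := ((hβ.mul ((hasDerivAt_iff_tendsto_slope.1 hW).mono_left hmono)).const_mul
    m3).mul_const P
  have hΔpos : ∀ᶠ y in 𝓝[<] (1 : ℝ), 0 < √(Delta l1 l2 m1 y) := by
    refine nhdsWithin_le_nhds ((hasDerivAt_sqrt_Delta_one hlt).continuousAt.eventually_const_lt ?_)
    simp only [sqrt_Delta_one hlt]
    linarith
  have hEpos : ∀ᶠ y in 𝓝[<] (1 : ℝ),
      0 < m2 * (m1 - l1 * alphaf l1 l2 m1 y) - m1 * l2 * y := by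
    have hc : ContinuousAt (fun y => m2 * (m1 - l1 * alphaf l1 l2 m1 y) - m1 * l2 * y) 1 := by
      have := ha.continuousAt
      fun_prop
    exact nhdsWithin_le_nhds (hc.eventually_const_lt (by simpa [ha1] using hE))
  have hmem : ∀ᶠ y in 𝓝[<] (1 : ℝ), y ∈ Ioo (0 : ℝ) 1 := Ioo_mem_nhdsLT one_pos
  have hfinal := tendsto_nhds_unique_of_eventuallyEq hlim hlim' (by
    filter_upwards [hΔpos, hEpos, hmem] with y hs hEy hy
    have hy1 : y - 1 ≠ 0 := by linarith [hy.2]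
    have hL2 := L2f_eq N hl1 hl2 hm1 hy.2.ne (Real.sqrt_pos.1 hs).le hEy.ne'
    have hx : x2f l1 l2 m1 y - alphaf l1 l2 m1 y = √(Delta l1 l2 m1 y) / l1 := by
      rw [x2f, alphaf]
      field_simp
      ring
    have hrhs : (l1 / m1 + l2 / m2) * L3f l1 l2 m1 m2 N y - (1 - l1 / m1 - l2 / m2)
          * (y * L2f l1 l2 m1 m2 N y + Lamf l1 l2 m1 m2 N y)
        = L3f l1 l2 m1 m2 N y * reducedRhs l1 l2 m1 m2 y := by
      rw [Lamf, hx, hL2, reducedRhs, div_div_eq_mul_div]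
      ring
    have h := heq y hy
    rw [hrhs] at h
    have hA1 : Afun l1 l2 m2 1 - l1 * alphaf l1 l2 m1 1 * 1 = 0 := by
      rw [Afun, ha1]
      ring
    have hn1 : l1 * (1 - alphaf l1 l2 m1 1) + l2 * (1 - 1) = 0 := by
      rw [ha1]
      ring
    simp only [slope_def_field, hA1, hn1, reducedRhs_one hl1 hm1 hm2 hlt hE.ne', sub_zero]
    field_simp
    linear_combination h)
  have hσ : 1 - l1 / m1 - l2 / m2 ≠ 0 := by linarith
  have hcoef : (m2 - l2 * m1 / (m1 - l1)) * q2 + -(l2 * m1 / (m1 - l1)) * q3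
      = m2 * ((1 / (1 - l1 / m1)) * ((1 - l1 / m1 - l2 / m2) * q2 - (l2 / m2) * q3)) := by
    field_simp
    ring
  rw [hcoef, one_mul, mul_div_cancel₀ _ hσ] at hfinal
  apply mul_left_cancel₀ hm2.ne'
  rw [hfinal]
  ring

end
end

section
/- Let λ1, λ2, μ1, μ2 > 0 with λ1+λ2+μ1+μ2 = 1 and ρ1 + ρ2 < 1, where ρ1 = λ1/μ1, ρ2 = λ2/μ2. Then: (1) (1−2μ1)² + 4(μ1−μ2)·λ2 ≥ 0, so that η1 and η2 are real; (2) η1 > 0; (3) η1 > η2, and if η1 < |η2| then η2 < 0; (4) η2 < 0 if and only if μ2 < μ1, η2 = 0 if and only if μ2 = μ1, and η2 > 0 if and only if μ2 > μ1; (5) η2 ≠ b1, and either T*(1/η2) = 0 or |η2| < b1. -/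
open Real Filter Topology Set

noncomputable section

/-- `Δ(y) = (F(y)/y)²` at the nonzero roots of `m2² - (1-2m1)·m2·y + (m2-m1)·l2·y²`. -/
lemma delta_eq_sq_of_root {l1 l2 m1 m2 y : ℝ} (hsum : l1 + l2 + m1 + m2 = 1) (hy : y ≠ 0)
    (hroot : m2 ^ 2 - (1 - 2 * m1) * m2 * y + (m2 - m1) * l2 * y ^ 2 = 0) :
    Delta l1 l2 m1 y = (Ff l2 m1 m2 y / y) ^ 2 := by
  obtain rfl : l1 = 1 - l2 - m1 - m2 := by linarith
  rw [div_pow, eq_div_iff (pow_ne_zero 2 hy)]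
  unfold Delta Ff
  linear_combination -4 * (1 - y) * hroot

lemma tstar_eq_zero_of_root {l1 l2 m1 m2 y : ℝ} (hsum : l1 + l2 + m1 + m2 = 1) (hy : y ≠ 0)
    (hroot : m2 ^ 2 - (1 - 2 * m1) * m2 * y + (m2 - m1) * l2 * y ^ 2 = 0)
    (hF : Ff l2 m1 m2 y / y ≤ 0) : Tstar l1 l2 m1 m2 y = 0 := by
  unfold Tstar
  rw [delta_eq_sq_of_root hsum hy hroot, Real.sqrt_sq_eq_abs, abs_of_nonpos hF]
  field_simp
  ring

lemma discriminant_pos {l1 l2 m1 m2 : ℝ} (hl1 : 0 < l1) (hl2 : 0 < l2)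
    (hsum : l1 + l2 + m1 + m2 = 1) : 0 < (1 - 2 * m1) ^ 2 + 4 * (m1 - m2) * l2 := by
  have hsq : (1 - 2 * m1) ^ 2 + 4 * (m1 - m2) * l2 = (m2 - m1 + l1 - l2) ^ 2 + 4 * (l1 * l2) := by
    obtain rfl : l1 = 1 - l2 - m1 - m2 := by linarith
    ring
  rw [hsq]
  positivity

/-- The value `(m2 - m1 + s)/m2`, with `s` the geometric mean of `l1` and `m1`, exceeds `η2`. -/
lemma eta2_mul_lt {l1 l2 m1 m2 s : ℝ} (hl1 : 0 < l1) (hl2 : 0 < l2) (hm2 : 0 < m2)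
    (hsum : l1 + l2 + m1 + m2 = 1) (hlt : m1 < m2) (hs : 0 < s) :
    eta2 l2 m1 m2 * m2 < m2 - m1 + s := by
  have hdisc := discriminant_pos hl1 hl2 hsum
  have hmul : eta2 l2 m1 m2 * m2 =
      (1 - 2 * m1 - √((1 - 2 * m1) ^ 2 + 4 * (m1 - m2) * l2)) / 2 := by
    unfold eta2
    field_simp
  rw [hmul]
  suffices h : 1 - 2 * m1 - 2 * (m2 - m1 + s) < √((1 - 2 * m1) ^ 2 + 4 * (m1 - m2) * l2) by
    linarith
  rcases lt_or_ge (1 - 2 * m1 - 2 * (m2 - m1 + s)) 0 with hneg | hnonneg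
  · exact hneg.trans_le (Real.sqrt_nonneg _)
  · apply Real.lt_sqrt_of_sq_lt
    have hlow := mul_le_mul_of_nonneg_left hnonneg hs.le
    have hpos := mul_pos hl1 (sub_pos.2 hlt)
    obtain rfl : l2 = 1 - l1 - m1 - m2 := by linarith
    nlinarith [mul_pos hs hs]

/-- Properties of the non-unit zeros `1/η1` and `1/η2`. -/
theorem stmt11 (l1 l2 m1 m2 : ℝ) (hl1 : 0 < l1) (hl2 : 0 < l2) (hm1 : 0 < m1) (hm2 : 0 < m2)
    (hsum : l1 + l2 + m1 + m2 = 1) (hr : l1 / m1 + l2 / m2 < 1) :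
    0 ≤ (1 - 2 * m1) ^ 2 + 4 * (m1 - m2) * l2 ∧
    0 < eta1 l2 m1 m2 ∧
    (eta2 l2 m1 m2 < eta1 l2 m1 m2 ∧
      (eta1 l2 m1 m2 < |eta2 l2 m1 m2| → eta2 l2 m1 m2 < 0)) ∧
    ((eta2 l2 m1 m2 < 0 ↔ m2 < m1) ∧ (eta2 l2 m1 m2 = 0 ↔ m2 = m1) ∧
      (0 < eta2 l2 m1 m2 ↔ m1 < m2)) ∧
    (eta2 l2 m1 m2 ≠ b1v l1 l2 m1 ∧
      (Tstar l1 l2 m1 m2 (1 / eta2 l2 m1 m2) = 0 ∨ |eta2 l2 m1 m2| < b1v l1 l2 m1)) := by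
  have hdisc := discriminant_pos hl1 hl2 hsum
  have hsqrt := Real.sqrt_pos.2 hdisc
  have hsq := Real.sq_sqrt hdisc.le
  have hbound := fun hlt => eta2_mul_lt hl1 hl2 hm2 hsum hlt
    (mul_pos (Real.sqrt_pos.2 hl1) (Real.sqrt_pos.2 hm1))
  have h1 : eta1 l2 m1 m2 * (2 * m2) =
      1 - 2 * m1 + √((1 - 2 * m1) ^ 2 + 4 * (m1 - m2) * l2) := by
    unfold eta1
    field_simp
  have h2 : eta2 l2 m1 m2 * (2 * m2) =
      1 - 2 * m1 - √((1 - 2 * m1) ^ 2 + 4 * (m1 - m2) * l2) := by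
    unfold eta2
    field_simp
  generalize √((1 - 2 * m1) ^ 2 + 4 * (m1 - m2) * l2) = R at *
  generalize eta1 l2 m1 m2 = x at *
  generalize eta2 l2 m1 m2 = z at *
  have hx : 0 < x := by
    refine pos_of_mul_pos_left (b := 2 * m2) ?_ (by positivity)
    rw [h1]
    by_contra! hle
    have hm : m2 < m1 := by linarith
    nlinarith [mul_pos (sub_pos.2 hm) hl2]
  have hzx : z < x := lt_of_mul_lt_mul_right (a := 2 * m2) (by linarith) (by positivity)
  have hprod : x * m2 ^ 2 * z = (m2 - m1) * l2 := by
    linear_combination (z * m2 / 2) * h1 + (1 - 2 * m1 + R) / 4 * h2 - hsq / 4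
  have hxm : 0 < x * m2 ^ 2 := by positivity
  have hpos : 0 < z ↔ m1 < m2 := by
    rw [← mul_pos_iff_of_pos_left hxm, hprod, mul_pos_iff_of_pos_right hl2, sub_pos]
  have hzero : z = 0 ↔ m2 = m1 := by
    rw [← mul_eq_zero_iff_left hxm.ne', hprod, mul_eq_zero_iff_right hl2.ne', sub_eq_zero]
  have hneg : z < 0 ↔ m2 < m1 := by
    rw [← not_le, ← not_le, le_iff_lt_or_eq, le_iff_lt_or_eq, hpos, eq_comm, hzero,
      eq_comm (a := m1)]
  have hroot : z ≠ 0 → m2 ^ 2 - (1 - 2 * m1) * m2 * (1 / z) + (m2 - m1) * l2 * (1 / z) ^ 2 = 0 := by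
    intro hz
    field_simp
    linear_combination (z * m2 / 2 - (1 - 2 * m1) / 4 - R / 4) * h2 + hsq / 4
  have hs2 : (√m1 - √l1) ^ 2 = m1 + l1 - 2 * (√l1 * √m1) := by
    rw [sub_sq, Real.sq_sqrt hm1.le, Real.sq_sqrt hl1.le]
    ring
  have hden : 0 < l2 + (√m1 - √l1) ^ 2 := by positivity
  have hb : 0 < b1v l1 l2 m1 := div_pos hl2 hden
  have hb_le : b1v l1 l2 m1 ≤ z → l2 ≤ z * (l2 + m1 + l1 - 2 * (√l1 * √m1)) := by
    intro h
    rw [b1v, div_le_iff₀ hden, hs2] at h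
    linarith
  have hFneg : b1v l1 l2 m1 ≤ z → Ff l2 m1 m2 (1 / z) / (1 / z) < 0 := by
    intro hbz
    have hz : 0 < z := hb.trans_le hbz
    have hlt := hbound (hpos.1 hz)
    have hle := hb_le hbz
    have hF : Ff l2 m1 m2 (1 / z) / (1 / z) = l2 / z - (1 - 2 * m1 + m2) + 2 * (z * m2) := by
      unfold Ff
      field_simp
    have hdiv : l2 / z ≤ l2 + m1 + l1 - 2 * (√l1 * √m1) := by
      rw [div_le_iff₀ hz]
      linarith
    rw [hF]
    linarith
  refine ⟨hdisc.le, hx, ⟨hzx, fun h => ?_⟩, ⟨hneg, hzero, hpos⟩, fun h => ?_, ?_⟩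
  · by_contra! hz
    rw [abs_of_nonneg hz] at h
    exact lt_asymm h hzx
  · have hz : 0 < z := h ▸ hb
    have hy : 1 / z ≠ 0 := (one_div_pos.2 hz).ne'
    have hl2z : l2 * (1 / z) = l2 + m1 + l1 - 2 * (√l1 * √m1) := by
      rw [h, b1v, hs2]
      rw [hs2] at hden
      field_simp
      ring
    have hD : Delta l1 l2 m1 (1 / z) = 0 := by
      unfold Delta
      rw [hl2z]
      have e1 := Real.sq_sqrt hl1.le
      have e2 := Real.sq_sqrt hm1.le
      linear_combination 4 * √m1 ^ 2 * e1 + 4 * l1 * e2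
    have hsqF := delta_eq_sq_of_root hsum hy (hroot hz.ne')
    rw [hD] at hsqF
    have := sq_pos_of_neg (hFneg h.ge)
    linarith
  · rcases lt_trichotomy z 0 with hz | hz | hz
    · left
      have hy : 1 / z < 0 := one_div_neg.2 hz
      refine tstar_eq_zero_of_root hsum hy.ne (hroot hz.ne)
        (div_nonpos_of_nonneg_of_nonpos ?_ hy.le)
      have hF : m2 * Ff l2 m1 m2 (1 / z) = m1 * l2 * (1 / z) ^ 2 + m2 ^ 2 + m2 ^ 2 * -(1 / z) := by
        unfold Ff
        linear_combination hroot hz.ne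
      refine (pos_of_mul_pos_right (a := m2) ?_ hm2.le).le
      have := neg_pos.2 hy
      rw [hF]
      positivity
    · right
      rwa [hz, abs_zero]
    · rw [abs_of_pos hz]
      rcases lt_or_ge z (b1v l1 l2 m1) with hlt | hge
      · exact Or.inr hlt
      · exact Or.inl (tstar_eq_zero_of_root hsum (one_div_pos.2 hz).ne' (hroot hz.ne')
          (hFneg hge).le)

end
end
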